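/- Let H be a real Hilbert space and C ⊆ H a nonempty closed convex set. For each time step t ∈ ℕ, let f_t : H → ℝ be differentiable, strongly convex with modulus σ > 0 and with L-Lipschitz gradient (L > 0), with minimizer z⋆_t over C, and suppose the optimizers drift slowly: ‖z⋆_t − z⋆_{t+1}‖ ≤ ρ for all t. Fix 0 < τ ≤ 1/L, κ with 1 − τσ < κ < 1, b ≥ 0, K ∈ ℕ, and set δ = τb/(κ − 1 + τσ). At each time t, generate iterates z^{t,k+1} = Proj_C(z^{t,k} − τ(∇f_t(z^{t,k}) + e^{t,k})) for k = 0, …, K, with errors ‖e^{t,k}‖ ≤ b·κ^k, and use the warm start z^{t+1,0} = z^{t,K+1}. If the initial point satisfies ‖z^{0,0} − z⋆_0‖ ≤ ε and the horizon K satisfies κ^{K+1}·(ε + ρ + δ) ≤ ε, then ‖z^{t,K+1} − z⋆_t‖ ≤ ε for every time step t ≥ 0. -/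

import Mathlib

open RealInnerProductSpace

section GradientSteps

variable {H : Type*} [NormedAddCommGroup H] [InnerProductSpace ℝ H]

/-- Points minimizing the distance to `v` over a convex set satisfy the variational inequality. -/
lemma inner_sub_le_zero_of_forall_norm_sub_le {C : Set H} (hC : Convex ℝ C) {v p : H}
    (hp : p ∈ C) (hmin : ∀ w ∈ C, ‖p - v‖ ≤ ‖w - v‖) {w : H} (hw : w ∈ C) :
    ⟪v - p, w - p⟫ ≤ 0 := by
  have : Nonempty C := ⟨⟨p, hp⟩⟩
  refine (norm_eq_iInf_iff_real_inner_le_zero hC hp).1 (le_antisymm ?_ ?_) w hw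
  · refine le_ciInf fun w => ?_
    rw [norm_sub_rev v p, norm_sub_rev v w]
    exact hmin w w.2
  · exact ciInf_le (f := fun w : C => ‖v - w‖)
      ⟨0, by rintro _ ⟨w, rfl⟩; exact norm_nonneg _⟩ ⟨p, hp⟩

/-- Two points satisfying the variational inequalities of the projections of `u` and `v` are at
most as far apart as `u` and `v`. -/
lemma norm_sub_le_of_inner_le_zero {u v p q : H} (hp : ⟪v - p, q - p⟫ ≤ 0)
    (hq : ⟪u - q, p - q⟫ ≤ 0) : ‖p - q‖ ≤ ‖v - u‖ := by
  have h : ‖p - q‖ ^ 2 ≤ ⟪v - u, p - q⟫ := by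
    rw [← real_inner_self_eq_norm_sq]
    simp only [inner_sub_left, inner_sub_right] at *
    linarith
  have h' := h.trans (real_inner_le_norm _ _)
  by_contra! hlt
  nlinarith [norm_nonneg (v - u)]

variable [CompleteSpace H]

/-- First-order optimality condition for a constrained minimizer. -/
lemma inner_gradient_nonneg_of_forall_le {C : Set H} (hC : Convex ℝ C) {φ : H → ℝ} {d q : H}
    (hφ : HasGradientAt φ d q) (hq : q ∈ C) (hmin : ∀ w ∈ C, φ q ≤ φ w) {w : H} (hw : w ∈ C) :
    0 ≤ ⟪d, w - q⟫ := by
  have h : IsLocalMinOn φ C q := IsMinOn.localize hmin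
  simpa using h.hasFDerivWithinAt_nonneg hφ.hasFDerivAt.hasFDerivWithinAt
    (sub_mem_posTangentConeAt_of_segment_subset (hC.segment_subset hq hw))

/-- The gradient of a quadratic minus a multiple of a differentiable function. -/
lemma HasGradientAt.half_mul_norm_sq_sub {φ : H → ℝ} {d x : H} (hφ : HasGradientAt φ d x)
    (a c : ℝ) : HasGradientAt (fun x => a / 2 * ‖x‖ ^ 2 - c * φ x) (a • x - c • d) x := by
  rw [hasGradientAt_iff_hasFDerivAt]
  refine HasFDerivAt.congr_fderiv (((hasStrictFDerivAt_norm_sq x).hasFDerivAt.const_mul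
    (a / 2)).sub (hφ.hasFDerivAt.const_mul c)) ?_
  ext w
  simp
  ring

/-- A function with monotone gradient lies above its tangent planes. -/
lemma add_inner_le_of_monotone_gradient {φ : H → ℝ} {h : H → H}
    (hφ : ∀ x, HasGradientAt φ (h x) x) (hmono : ∀ x y, 0 ≤ ⟪h x - h y, x - y⟫) (u v : H) :
    φ u + ⟪h u, v - u⟫ ≤ φ v := by
  have hd : ∀ s : ℝ, HasDerivAt (fun s : ℝ => φ (u + s • (v - u)))
      ⟪h (u + s • (v - u)), v - u⟫ s := fun s => by
    have hl : HasDerivAt (fun s : ℝ => u + s • (v - u)) (v - u) s := by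
      simpa using ((hasDerivAt_id s).smul_const (v - u)).const_add u
    exact (hφ (u + s • (v - u))).hasFDerivAt.comp_hasDerivAt s hl
  obtain ⟨c, hc, hceq⟩ := exists_hasDerivAt_eq_slope _ _ zero_lt_one
    (fun s _ => (hd s).continuousAt.continuousWithinAt) (fun s _ => hd s)
  have hm := hmono (u + c • (v - u)) u
  rw [add_sub_cancel_left, inner_smul_right] at hm
  have hm' := nonneg_of_mul_nonneg_right hm hc.1
  rw [inner_sub_left] at hm'
  simp at hceq
  linarith

/-- Baillon–Haddad: a monotone gradient with one-sided Lipschitz constant `M` is cocoercive. -/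
lemma norm_sq_gradient_sub_le {φ : H → ℝ} {h : H → H} {M : ℝ}
    (hφ : ∀ x, HasGradientAt φ (h x) x) (hmono : ∀ x y, 0 ≤ ⟪h x - h y, x - y⟫)
    (hM : ∀ x y, ⟪h x - h y, x - y⟫ ≤ M * ‖x - y‖ ^ 2) (hM0 : 0 ≤ M) (x y : H) :
    ‖h x - h y‖ ^ 2 ≤ M * ⟪h x - h y, x - y⟫ := by
  have hup : ∀ u v, φ v ≤ φ u + ⟪h u, v - u⟫ + M / 2 * ‖v - u‖ ^ 2 := fun u v => by
    have key := add_inner_le_of_monotone_gradient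
      (φ := fun x => M / 2 * ‖x‖ ^ 2 - φ x) (h := fun x => M • x - h x) (fun x => by
        simpa using (hφ x).half_mul_norm_sq_sub M 1) (fun x y => by
        have := hM x y
        rw [← real_inner_self_eq_norm_sq] at this
        simp only [inner_sub_left, inner_sub_right, inner_smul_left, RCLike.conj_to_real] at *
        linarith) u v
    simp only [← real_inner_self_eq_norm_sq, inner_sub_left, inner_sub_right, inner_smul_left,
      RCLike.conj_to_real, real_inner_comm u v] at *
    linarith
  have hs : ∀ (s : ℝ) (x y : H), φ x + ⟪h x, y - x⟫ + s * ‖h x - h y‖ ^ 2 ≤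
      φ y + M / 2 * (s ^ 2 * ‖h x - h y‖ ^ 2) := fun s x y => by
    have h1 := add_inner_le_of_monotone_gradient hφ hmono x (y + s • (h x - h y))
    have h2 := hup y (y + s • (h x - h y))
    rw [add_sub_cancel_left, norm_smul, mul_pow, Real.norm_eq_abs, sq_abs] at h2
    rw [add_sub_right_comm, inner_add_right] at h1
    have h3 : s * ‖h x - h y‖ ^ 2 = ⟪h x, s • (h x - h y)⟫ - ⟪h y, s • (h x - h y)⟫ := by
      rw [← inner_sub_left, inner_smul_right, real_inner_self_eq_norm_sq]
    linarith
  have hsum : ∀ s : ℝ, 2 * s * ‖h x - h y‖ ^ 2 ≤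
      M * s ^ 2 * ‖h x - h y‖ ^ 2 + ⟪h x - h y, x - y⟫ := fun s => by
    have h1 := hs s x y
    have h2 := hs s y x
    rw [norm_sub_rev (h y)] at h2
    simp only [inner_sub_left, inner_sub_right] at *
    linarith
  generalize ‖h x - h y‖ ^ 2 = A at *
  generalize ⟪h x - h y, x - y⟫ = B at *
  rcases hM0.eq_or_lt with rfl | hM0
  · by_contra! hA
    rw [zero_mul] at hA
    have := hsum ((B + 1) / A)
    field_simp at this
    nlinarith [hsum 0]
  · have := hsum (1 / M)
    field_simp at this
    linarith

/-- A gradient step of length `τ ≤ 1 / L` contracts with ratio `1 - τ * σ`. -/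
lemma norm_gradient_step_sub_le {φ : H → ℝ} {g : H → H} {L σ τ : ℝ}
    (hφ : ∀ x, HasGradientAt φ (g x) x) (hL : 0 < L)
    (hLip : ∀ x y, ‖g x - g y‖ ≤ L * ‖x - y‖)
    (hσ : ∀ x y, σ * ‖x - y‖ ^ 2 ≤ ⟪g x - g y, x - y⟫)
    (hτ0 : 0 < τ) (hτL : τ ≤ 1 / L) (hM : 0 ≤ 1 - τ * σ) (x y : H) :
    ‖(x - τ • g x) - (y - τ • g y)‖ ≤ (1 - τ * σ) * ‖x - y‖ := by
  have hexp : ∀ x y, ⟪(x - τ • g x) - (y - τ • g y), x - y⟫ =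
      ‖x - y‖ ^ 2 - τ * ⟪g x - g y, x - y⟫ := fun x y => by
    rw [← real_inner_self_eq_norm_sq]
    simp only [inner_sub_left, inner_sub_right, inner_smul_left, RCLike.conj_to_real]
    ring
  have hle : ∀ x y, ⟪(x - τ • g x) - (y - τ • g y), x - y⟫ ≤ (1 - τ * σ) * ‖x - y‖ ^ 2 :=
    fun x y => by
      rw [hexp]
      nlinarith [hσ x y]
  have key := norm_sq_gradient_sub_le (φ := fun x => 1 / 2 * ‖x‖ ^ 2 - τ * φ x)
    (h := fun x => x - τ • g x) (fun x => by
      simpa using (hφ x).half_mul_norm_sq_sub 1 τ) (fun x y => by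
      have h1 : ⟪g x - g y, x - y⟫ ≤ L * ‖x - y‖ ^ 2 :=
        (real_inner_le_norm _ _).trans (by nlinarith [hLip x y, norm_nonneg (x - y)])
      have h2 : τ * L ≤ 1 := (le_div_iff₀ hL).1 hτL
      have h3 := mul_le_mul_of_nonneg_left h1 hτ0.le
      have h4 := mul_le_mul_of_nonneg_right h2 (sq_nonneg ‖x - y‖)
      rw [hexp]
      linarith) hle hM x y
  refine le_of_sq_le_sq ?_ (by positivity)
  exact key.trans ((mul_le_mul_of_nonneg_left (hle x y) hM).trans_eq (by ring))

end GradientSteps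

/-- A perturbed linear recursion whose perturbation decays geometrically with ratio `κ ≥ M`. -/
lemma le_pow_mul_add_of_le_mul_add {a : ℕ → ℝ} {M κ δ : ℝ} {K : ℕ} (hM : 0 ≤ M) (hMκ : M ≤ κ)
    (ha : 0 ≤ a 0) (hδ : 0 ≤ δ)
    (hstep : ∀ k ≤ K, a (k + 1) ≤ M * a k + δ * (κ - M) * κ ^ k) :
    ∀ k ≤ K + 1, a k ≤ κ ^ k * (a 0 + δ) := by
  intro k
  induction k with
  | zero => intro _; simpa using hδ
  | succ k ih =>
    intro hk
    have h1 := hstep k (by lia)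
    have h2 := mul_le_mul_of_nonneg_left (ih (by lia)) hM
    have h3 : 0 ≤ (κ - M) * (κ ^ k * a 0) :=
      mul_nonneg (sub_nonneg.2 hMκ) (mul_nonneg (pow_nonneg (hM.trans hMκ) k) ha)
    rw [pow_succ]
    linarith

/-- **Warm-started parametric tracking guarantee (Theorem 1).**
Let `C` be a nonempty closed convex subset of a real Hilbert space `H`. For
each time step `t`, let `f_t : H → ℝ` be differentiable (with gradient `g_t`),
strongly convex with modulus `σ > 0`, with `L`-Lipschitz gradient (`L > 0`),
with minimizer `z⋆_t` over `C`, and suppose `‖z⋆_t - z⋆_{t+1}‖ ≤ ρ`. Fix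
`0 < τ ≤ 1/L`, `1 - τσ < κ < 1`, `b ≥ 0`, `K`, and set
`δ = τ b / (κ - 1 + τσ)`. Generate `z^{t,k+1} = Proj_C (z^{t,k} - τ (∇f_t(z^{t,k}) + e^{t,k}))`
for `k = 0, …, K` with `‖e^{t,k}‖ ≤ b κ^k`, warm-started by
`z^{t+1,0} = z^{t,K+1}`. If `‖z^{0,0} - z⋆_0‖ ≤ ε` and `κ^{K+1} (ε + ρ + δ) ≤ ε`,
then `‖z^{t,K+1} - z⋆_t‖ ≤ ε` for every `t`. -/
theorem warm_started_parametric_tracking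
    {H : Type*} [NormedAddCommGroup H] [InnerProductSpace ℝ H] [CompleteSpace H]
    (C : Set H) (hCne : C.Nonempty) (hCclosed : IsClosed C) (hCconv : Convex ℝ C)
    (f : ℕ → H → ℝ) (g : ℕ → H → H)
    (hdiff : ∀ (t : ℕ) (x : H), HasGradientAt (f t) (g t x) x)
    (L σ : ℝ) (hL : 0 < L) (hσ : 0 < σ)
    (hLip : ∀ (t : ℕ) (x y : H), ‖g t x - g t y‖ ≤ L * ‖x - y‖)
    (hStrong : ∀ (t : ℕ) (x y : H), σ * ‖x - y‖ ^ 2 ≤ ⟪g t x - g t y, x - y⟫)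
    (zstar : ℕ → H) (hzC : ∀ t, zstar t ∈ C)
    (hmin : ∀ t, ∀ w ∈ C, f t (zstar t) ≤ f t w)
    (ρ : ℝ) (hdrift : ∀ t, ‖zstar t - zstar (t + 1)‖ ≤ ρ)
    (Proj : H → H)
    (hProj : ∀ v : H, Proj v ∈ C ∧ ∀ w ∈ C, ‖Proj v - v‖ ≤ ‖w - v‖)
    (τ κ b : ℝ) (hτ0 : 0 < τ) (hτL : τ ≤ 1 / L)
    (hκlb : 1 - τ * σ < κ) (hκ1 : κ < 1) (hb : 0 ≤ b)
    (K : ℕ) (δ : ℝ) (hδ : δ = τ * b / (κ - 1 + τ * σ))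
    (z : ℕ → ℕ → H) (e : ℕ → ℕ → H)
    (hiter : ∀ (t : ℕ) (k : ℕ), k ≤ K →
      z t (k + 1) = Proj (z t k - τ • (g t (z t k) + e t k)))
    (herr : ∀ (t : ℕ) (k : ℕ), k ≤ K → ‖e t k‖ ≤ b * κ ^ k)
    (hwarm : ∀ t : ℕ, z (t + 1) 0 = z t (K + 1))
    (ε : ℝ) (hinit : ‖z 0 0 - zstar 0‖ ≤ ε)
    (hK : κ ^ (K + 1) * (ε + ρ + δ) ≤ ε) :
    ∀ t : ℕ, ‖z t (K + 1) - zstar t‖ ≤ ε := by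
  rcases subsingleton_or_nontrivial H with hH | hH
  · intro t
    rw [Subsingleton.elim (z t (K + 1) - zstar t) (z 0 0 - zstar 0)]
    exact hinit
  have hτL1 : τ * L ≤ 1 := (le_div_iff₀ hL).1 hτL
  have hσL : σ ≤ L := by
    obtain ⟨x, y, hxy⟩ := exists_pair_ne H
    have hpos : 0 < ‖x - y‖ := norm_pos_iff.2 (sub_ne_zero.2 hxy)
    have h := (hStrong 0 x y).trans (real_inner_le_norm _ _)
    have h' := mul_le_mul_of_nonneg_right (hLip 0 x y) hpos.le
    exact le_of_mul_le_mul_right (by linarith) (pow_pos hpos 2)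
  have hM : 0 ≤ 1 - τ * σ := by nlinarith
  have hκ : 0 < κ - (1 - τ * σ) := sub_pos.2 hκlb
  have hκδ : δ * (κ - (1 - τ * σ)) = τ * b := by
    rw [hδ, show κ - 1 + τ * σ = κ - (1 - τ * σ) by ring, div_mul_cancel₀ _ hκ.ne']
  have hδ0 : 0 ≤ δ := nonneg_of_mul_nonneg_left (hκδ ▸ by positivity) hκ
  have hstep : ∀ t, ∀ k ≤ K, ‖z t (k + 1) - zstar t‖ ≤
      (1 - τ * σ) * ‖z t k - zstar t‖ + δ * (κ - (1 - τ * σ)) * κ ^ k := fun t k hk => by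
    obtain ⟨hpC, hpmin⟩ := hProj (z t k - τ • (g t (z t k) + e t k))
    rw [hiter t k hk, hκδ]
    have hopt := inner_gradient_nonneg_of_forall_le hCconv (hdiff t _) (hzC t) (hmin t) hpC
    have hle := norm_sub_le_of_inner_le_zero (u := zstar t - τ • g t (zstar t))
      (inner_sub_le_zero_of_forall_norm_sub_le hCconv hpC hpmin (hzC t)) (by
        rw [sub_sub_cancel_left, inner_neg_left, inner_smul_left, RCLike.conj_to_real]
        nlinarith)
    refine hle.trans ?_
    have hsplit : z t k - τ • (g t (z t k) + e t k) - (zstar t - τ • g t (zstar t)) =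
        ((z t k - τ • g t (z t k)) - (zstar t - τ • g t (zstar t))) - τ • e t k := by
      module
    rw [hsplit]
    refine (norm_sub_le _ _).trans (add_le_add
      (norm_gradient_step_sub_le (hdiff t) hL (hLip t) (hStrong t) hτ0 hτL hM _ _) ?_)
    rw [norm_smul, Real.norm_of_nonneg hτ0.le, mul_assoc]
    exact mul_le_mul_of_nonneg_left (herr t k hk) hτ0.le
  have hρ : 0 ≤ ρ := (norm_nonneg _).trans (hdrift 0)
  have hround : ∀ t, ‖z t 0 - zstar t‖ ≤ ε + ρ → ‖z t (K + 1) - zstar t‖ ≤ ε := fun t ht =>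
    (le_pow_mul_add_of_le_mul_add (a := fun k => ‖z t k - zstar t‖) hM hκlb.le
      (norm_nonneg _) hδ0 (hstep t) (K + 1) le_rfl).trans
      ((mul_le_mul_of_nonneg_left (add_le_add_left ht δ)
        (pow_nonneg (hM.trans hκlb.le) _)).trans hK)
  intro t
  induction t with
  | zero => exact hround 0 (hinit.trans (le_add_of_nonneg_right hρ))
  | succ t ih =>
    refine hround (t + 1) ?_
    rw [hwarm]
    exact (norm_sub_le_norm_sub_add_norm_sub _ (zstar t) _).trans (add_le_add ih (hdrift t))
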